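/- arXiv:1904.09647 — 6 statements merged into one kernel-verified Lean document; each statement's English description precedes it below -/
import Mathlib

section
/- Let (M,d) be a metric space, n ≥ 1, design points 0 ≤ t_1 ≤ … ≤ t_n ≤ 1, data Y_1, …, Y_n ∈ M and λ ≥ 0. For any function μ̃ : [0,1] → M of finite total variation that minimizes the total variation penalized loss L_λ, there exists a step function μ̂ : [0,1] → M (namely, with t_0 = 0 and t_{n+1} = 1, the function defined by μ̂(t) = μ̃(t_i) for t ∈ [t_i, t_{i+1}) and μ̂(1) = μ̃(t_n)) such that μ̂(t_i) = μ̃(t_i) for all i = 1, …, n and TV(μ̂) ≤ TV(μ̃); in particular, μ̂ is also a minimizer of L_λ. -/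
open Set Finset
open scoped ENNReal

/-- Total variation of a function over the interval `[0,1]`:
the supremum over finite monotone sequences in `[0,1]` of the sums of
consecutive distances. -/
noncomputable def TV {M : Type*} [PseudoEMetricSpace M] (g : ℝ → M) : ℝ≥0∞ :=
  eVariationOn g (Set.Icc 0 1)

/-- The total variation penalized loss
`L_λ(g) = (1/n) ∑ᵢ d(g(tᵢ), Yᵢ)² + λ TV(g)`. -/
noncomputable def Lloss {M : Type*} [MetricSpace M] {n : ℕ} (t : Fin n → ℝ)
    (Y : Fin n → M) (lam : ℝ) (g : ℝ → M) : ℝ :=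
  (1 / (n : ℝ)) * ∑ i, dist (g (t i)) (Y i) ^ 2 + lam * (TV g).toReal

/-- The step function associated with `f` and design points `t`: with `t_0 = 0` and
`t_{n+1} = 1`, it sends `s ∈ [t_i, t_{i+1})` to `f(t_i)` (in particular `s ∈ [0, t_1)`
to `f(0)`) and `1` to `f(t_n)`; equivalently, it sends `s` to `f(t_j)` where `t_j`
is the largest design point that is `≤ s`, and to `f 0` if there is none. -/
noncomputable def stepExt {M : Type*} {n : ℕ} (t : Fin n → ℝ) (f : ℝ → M) : ℝ → M :=
  fun s =>
    if h : (Finset.univ.filter (fun i => t i ≤ s)).Nonempty then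
      f (t ((Finset.univ.filter (fun i => t i ≤ s)).max' h))
    else f 0

noncomputable def stepPt {n : ℕ} (t : Fin n → ℝ) : ℝ → ℝ := stepExt t id

lemma stepExt_eq_comp {M : Type*} {n : ℕ} (t : Fin n → ℝ) (f : ℝ → M) :
    stepExt t f = f ∘ stepPt t := by
  funext s
  simp only [stepPt, stepExt, Function.comp]
  split_ifs <;> rfl

lemma stepPt_le {n : ℕ} (t : Fin n → ℝ) {s : ℝ} (hs : 0 ≤ s) : stepPt t s ≤ s := by
  simp only [stepPt, stepExt, id]
  split_ifs with h
  · exact (Finset.mem_filter.1 (Finset.max'_mem _ h)).2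
  · exact hs

lemma le_stepPt {n : ℕ} (t : Fin n → ℝ) (ht : Monotone t) {s : ℝ} {i : Fin n} (hi : t i ≤ s) :
    t i ≤ stepPt t s := by
  have hm : i ∈ Finset.univ.filter (fun i => t i ≤ s) := by simp [hi]
  have h : (Finset.univ.filter (fun i => t i ≤ s)).Nonempty := ⟨i, hm⟩
  simp only [stepPt, stepExt, id, dif_pos h]
  exact ht (Finset.le_max' _ _ hm)

lemma stepPt_nonneg {n : ℕ} (t : Fin n → ℝ) (h0 : ∀ i, 0 ≤ t i) (s : ℝ) : 0 ≤ stepPt t s := by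
  simp only [stepPt, stepExt, id]
  split_ifs with h
  · exact h0 _
  · exact le_rfl

lemma stepPt_mono {n : ℕ} (t : Fin n → ℝ) (ht : Monotone t) (h0 : ∀ i, 0 ≤ t i) :
    Monotone (stepPt t) := by
  intro a b hab
  by_cases h : (Finset.univ.filter (fun i => t i ≤ a)).Nonempty
  · have e : stepPt t a = t ((Finset.univ.filter (fun i => t i ≤ a)).max' h) := by
      simp only [stepPt, stepExt, id, dif_pos h]
    rw [e]
    exact le_stepPt t ht ((Finset.mem_filter.1 (Finset.max'_mem _ h)).2.trans hab)
  · have e : stepPt t a = 0 := by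
      simp only [stepPt, stepExt, id, dif_neg h]
    rw [e]
    exact stepPt_nonneg t h0 b

/-- if `μ̃` has finite total variation and minimizes the total variation
penalized loss `L_λ`, then the associated step function `μ̂ = stepExt t μ̃` agrees with
`μ̃` at all design points, has total variation at most `TV(μ̃)`, and is also a minimizer
of `L_λ`. -/
theorem step_function_minimizer {M : Type*} [MetricSpace M] (n : ℕ) (hn : 1 ≤ n)
    (t : Fin n → ℝ) (ht : Monotone t) (ht01 : ∀ i, t i ∈ Set.Icc (0 : ℝ) 1)
    (Y : Fin n → M) (lam : ℝ) (hlam : 0 ≤ lam)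
    (μt : ℝ → M) (hμt : TV μt ≠ ⊤)
    (hmin : ∀ g : ℝ → M, TV g ≠ ⊤ → Lloss t Y lam μt ≤ Lloss t Y lam g) :
    (∀ i, stepExt t μt (t i) = μt (t i)) ∧
      TV (stepExt t μt) ≤ TV μt ∧
      ∀ g : ℝ → M, TV g ≠ ⊤ → Lloss t Y lam (stepExt t μt) ≤ Lloss t Y lam g := by
  have h0 : ∀ i, 0 ≤ t i := fun i => (ht01 i).1
  have h1 : ∀ i, stepExt t μt (t i) = μt (t i) := by
    intro i
    rw [stepExt_eq_comp, Function.comp,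
      le_antisymm (stepPt_le t (h0 i)) (le_stepPt t ht le_rfl)]
  have h2 : TV (stepExt t μt) ≤ TV μt := by
    rw [stepExt_eq_comp]
    refine eVariationOn.comp_le_of_monotoneOn μt (stepPt t)
      ((stepPt_mono t ht h0).monotoneOn _) ?_
    intro s hs
    exact ⟨stepPt_nonneg t h0 s, (stepPt_le t hs.1).trans hs.2⟩
  refine ⟨h1, h2, fun g hg => le_trans ?_ (hmin g hg)⟩
  simp only [Lloss, h1]
  have := ENNReal.toReal_mono hμt h2
  gcongr
end

section
/- Let (M,d) be a metric space, n ≥ 1, strictly increasing design points 0 ≤ t_1 < … < t_n ≤ 1, data Y_1, …, Y_n ∈ M and λ ≥ 0. Then the infimum of the total variation penalized loss L_λ(g) over all functions g : [0,1] → M with TV(g) < ∞ equals the infimum over all tuples (p_1, …, p_n) ∈ M^n of (1/n) Σ_{i=1}^n d(p_i, Y_i)^2 + λ Σ_{i=1}^{n-1} d(p_i, p_{i+1}). -/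
open Set
open scoped ENNReal

lemma aux_var {M : Type*} [MetricSpace M] (N : ℕ) (p : Fin (N + 1) → M) :
    eVariationOn p univ = ENNReal.ofReal (∑ i : Fin N, dist (p i.castSucc) (p i.succ)) := by
  let u : ℕ → Fin (N + 1) := fun k => ⟨min k N, by omega⟩
  have hu : Monotone u := by
    intro a b hab
    simp only [u, Fin.mk_le_mk]
    omega
  have h1 : u '' Iic N = univ := by
    ext x
    simp only [mem_image, mem_Iic, mem_univ, iff_true]
    refine ⟨x, by omega, ?_⟩
    ext
    simp only [u]
    omega
  rw [← h1, eVariationOn.image_range_of_monotone p hu N,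
    ENNReal.ofReal_sum_of_nonneg (fun _ _ => dist_nonneg), Finset.sum_range]
  refine Finset.sum_congr rfl fun i _ => ?_
  have ha : u i = i.castSucc := by
    ext
    simp only [u, Fin.val_castSucc]
    omega
  have hb : u (i + 1) = i.succ := by
    ext
    simp only [u, Fin.val_succ]
    omega
  rw [ha, hb, edist_dist]

lemma aux_retr (N : ℕ) (t : Fin (N + 1) → ℝ) (ht : StrictMono t) :
    ∃ φ : ℝ → Fin (N + 1), Monotone φ ∧ ∀ i, φ (t i) = i := by
  classical
  refine ⟨fun x => ⟨(Finset.univ.filter fun i : Fin N => t i.succ ≤ x).card, ?_⟩, ?_, ?_⟩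
  · have := Finset.card_filter_le (Finset.univ : Finset (Fin N)) (fun i : Fin N => t i.succ ≤ x)
    simp only [Finset.card_univ, Fintype.card_fin] at this
    omega
  · intro x y hxy
    simp only [Fin.mk_le_mk]
    apply Finset.card_le_card
    intro i hi
    simp only [Finset.mem_filter, Finset.mem_univ, true_and] at hi ⊢
    exact hi.trans hxy
  · intro j
    ext
    simp only [ht.le_iff_le]
    have : (Finset.univ.filter fun i : Fin N => i.succ ≤ j)
        = (Finset.univ.filter fun i : Fin N => i.val < j.val) := by
      ext i
      simp [Fin.le_def, Nat.succ_le_iff]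
    rw [this, Fin.card_filter_val_lt]
    omega

/-- with `n = N + 1 ≥ 1` strictly increasing design points in `[0,1]`,
the infimum of `L_λ` over all functions of finite total variation equals the infimum
over tuples `(p_1, …, p_n) ∈ Mⁿ` of
`(1/n) ∑ᵢ d(pᵢ, Yᵢ)² + λ ∑_{i=1}^{n-1} d(pᵢ, p_{i+1})`. -/
theorem inf_loss_eq_inf_tuples {M : Type*} [MetricSpace M] (N : ℕ)
    (t : Fin (N + 1) → ℝ) (ht : StrictMono t) (ht01 : ∀ i, t i ∈ Set.Icc (0 : ℝ) 1)
    (Y : Fin (N + 1) → M) (lam : ℝ) (hlam : 0 ≤ lam) :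
    sInf {r : ℝ | ∃ g : ℝ → M, TV g ≠ ⊤ ∧ Lloss t Y lam g = r} =
      sInf {r : ℝ | ∃ p : Fin (N + 1) → M,
        (1 / ((N : ℝ) + 1)) * ∑ i, dist (p i) (Y i) ^ 2 +
          lam * ∑ i : Fin N, dist (p i.castSucc) (p i.succ) = r} := by
  have hc : ((N + 1 : ℕ) : ℝ) = (N : ℝ) + 1 := by push_cast; rfl
  have S0 : ∀ p : Fin (N + 1) → M, 0 ≤ ∑ i : Fin N, dist (p i.castSucc) (p i.succ) :=
    fun p => Finset.sum_nonneg fun _ _ => dist_nonneg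
  obtain ⟨φ, hφ, hφt⟩ := aux_retr N t ht
  -- from tuples to functions
  have A : ∀ p : Fin (N + 1) → M, ∃ g : ℝ → M, TV g ≠ ⊤ ∧ Lloss t Y lam g ≤
      (1 / ((N : ℝ) + 1)) * ∑ i, dist (p i) (Y i) ^ 2 +
          lam * ∑ i : Fin N, dist (p i.castSucc) (p i.succ) := by
    intro p
    have h : TV (p ∘ φ) ≤ ENNReal.ofReal (∑ i : Fin N, dist (p i.castSucc) (p i.succ)) := by
      rw [← aux_var]
      exact eVariationOn.comp_le_of_monotoneOn p φ (hφ.monotoneOn _) (mapsTo_univ _ _)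
    refine ⟨p ∘ φ, ne_top_of_le_ne_top ENNReal.ofReal_ne_top h, ?_⟩
    unfold Lloss
    simp only [Function.comp_apply, hφt, hc]
    gcongr
    exact ENNReal.toReal_le_of_le_ofReal (S0 p) h
  have B : ∀ g : ℝ → M, TV g ≠ ⊤ →
      (1 / ((N : ℝ) + 1)) * ∑ i, dist (g (t i)) (Y i) ^ 2 +
          lam * ∑ i : Fin N, dist (g (t i.castSucc)) (g (t i.succ)) ≤ Lloss t Y lam g := by
    intro g hg
    have h : ENNReal.ofReal (∑ i : Fin N, dist (g (t i.castSucc)) (g (t i.succ))) ≤ TV g := by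
      have := aux_var N (g ∘ t)
      simp only [Function.comp_apply] at this
      rw [← this]
      exact eVariationOn.comp_le_of_monotoneOn g t (ht.monotone.monotoneOn _)
        (fun i _ => ht01 i)
    unfold Lloss
    rw [hc]
    gcongr
    exact (ENNReal.ofReal_le_iff_le_toReal hg).1 h
  apply le_antisymm
  · refine le_csInf ⟨_, Y, rfl⟩ ?_
    rintro r ⟨p, rfl⟩
    obtain ⟨g, hg, hl⟩ := A p
    refine le_trans (csInf_le ⟨0, ?_⟩ ⟨g, hg, rfl⟩) hl
    rintro r ⟨g, -, rfl⟩
    unfold Lloss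
    positivity
  · obtain ⟨g₀, hg₀, -⟩ := A Y
    refine le_csInf ⟨_, g₀, hg₀, rfl⟩ ?_
    rintro r ⟨g, hg, rfl⟩
    refine le_trans (csInf_le ⟨0, ?_⟩ ⟨fun i => g (t i), rfl⟩) (B g hg)
    rintro r ⟨p, rfl⟩
    positivity
end

section
/- Let (M,d) be a metric space, n ≥ 1, design points 0 < t_1 ≤ … ≤ t_n < 1, data Y_1, …, Y_n ∈ M and λ > 0. If μ̂ : [0,1] → M has finite total variation and minimizes the total variation penalized loss L_λ over all functions of finite total variation, then μ̂ is constant near the boundary: μ̂(t) = μ̂(t_1) for all t ∈ [0, t_1] and μ̂(t) = μ̂(t_n) for all t ∈ [t_n, 1]. -/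
open Set
open scoped ENNReal

/-- with `n = N + 1 ≥ 1` design points `0 < t_1 ≤ ⋯ ≤ t_n < 1` and `λ > 0`,
any minimizer `μ̂` of `L_λ` over functions of finite total variation is constant near the
boundary: `μ̂(s) = μ̂(t_1)` for `s ∈ [0, t_1]` and `μ̂(s) = μ̂(t_n)` for `s ∈ [t_n, 1]`. -/
theorem minimizer_constant_near_boundary {M : Type*} [MetricSpace M] (N : ℕ)
    (t : Fin (N + 1) → ℝ) (ht : Monotone t)
    (ht0 : ∀ i, 0 < t i) (ht1 : ∀ i, t i < 1)
    (Y : Fin (N + 1) → M) (lam : ℝ) (hlam : 0 < lam)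
    (μhat : ℝ → M) (hμhat : TV μhat ≠ ⊤)
    (hmin : ∀ g : ℝ → M, TV g ≠ ⊤ → Lloss t Y lam μhat ≤ Lloss t Y lam g) :
    (∀ s ∈ Set.Icc (0 : ℝ) (t 0), μhat s = μhat (t 0)) ∧
      (∀ s ∈ Set.Icc (t (Fin.last N)) (1 : ℝ), μhat s = μhat (t (Fin.last N))) := by
  have hab : t 0 ≤ t (Fin.last N) := ht (Fin.zero_le _)
  have ha := ht0 0
  have hb := ht1 (Fin.last N)
  have hge : ∀ i, t 0 ≤ t i := fun i => ht (Fin.zero_le _)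
  have hle : ∀ i, t i ≤ t (Fin.last N) := fun i => ht (Fin.le_last _)
  generalize t 0 = a at *
  generalize t (Fin.last N) = b at *
  have hsplit : TV μhat = eVariationOn μhat (Icc 0 a) + eVariationOn μhat (Icc a b)
      + eVariationOn μhat (Icc b 1) := by
    have h1 := eVariationOn.Icc_add_Icc μhat (s := univ) ha.le hab (mem_univ a)
    have h2 := eVariationOn.Icc_add_Icc μhat (s := univ) (ha.le.trans hab) hb.le (mem_univ b)
    simp only [univ_inter] at h1 h2
    rw [h1, h2, TV]
  have hclamp : TV (μhat ∘ fun x => max a (min b x)) ≤ eVariationOn μhat (Icc a b) := by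
    refine eVariationOn.comp_le_of_monotoneOn μhat _ ?_ ?_
    · intro x _ y _ hxy
      dsimp only
      gcongr
    · intro x _
      exact ⟨le_max_left _ _, max_le hab (min_le_left _ _)⟩
  have hVle : eVariationOn μhat (Icc a b) ≤ TV μhat :=
    eVariationOn.mono _ (Icc_subset_Icc ha.le hb.le)
  have hVtop : eVariationOn μhat (Icc a b) ≠ ⊤ := ne_top_of_le_ne_top hμhat hVle
  have hgtop := ne_top_of_le_ne_top hVtop hclamp
  have hm := hmin _ hgtop
  have heq : ∀ i, (μhat ∘ fun x => max a (min b x)) (t i) = μhat (t i) := by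
    intro i
    simp [min_eq_right (hle i), max_eq_right (hge i)]
  simp only [Lloss, heq] at hm
  have hm2 := le_of_mul_le_mul_left (le_of_add_le_add_left hm) hlam
  have hm3 := ((ENNReal.toReal_le_toReal hμhat hgtop).1 hm2).trans hclamp
  have hz : eVariationOn μhat (Icc 0 a) + eVariationOn μhat (Icc b 1) = 0 := by
    rw [hsplit, add_right_comm] at hm3
    have h4 : eVariationOn μhat (Icc 0 a) + eVariationOn μhat (Icc b 1)
        + eVariationOn μhat (Icc a b) ≤ 0 + eVariationOn μhat (Icc a b) := by simpa using hm3
    exact le_antisymm ((ENNReal.add_le_add_iff_right hVtop).1 h4) zero_le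
  obtain ⟨h0, h1⟩ := add_eq_zero.1 hz
  rw [eVariationOn.eq_zero_iff] at h0 h1
  exact ⟨fun s hs => edist_eq_zero.1 (h0 s hs a ⟨ha.le, le_rfl⟩),
    fun s hs => edist_eq_zero.1 (h1 s hs b ⟨le_rfl, hb.le⟩)⟩
end

section
/- Let (X,d) be a metric space of finite diameter R > 0 such that for constants α, K > 0 one has sup_{x ∈ X} log N(εδ, B_x(δ), d) ≤ K ε^{-α} for all ε, δ > 0, where B_x(δ) is the closed ball of radius δ centered at x. Fix L > 0 and let B(L) be the collection of all L-Lipschitz functions from [0,1] to X. Then for any n ≥ 1, any design points 0 ≤ t_1 ≤ … ≤ t_n ≤ 1, and every δ > 0, the covering number of B(L) with respect to the empirical pseudo-metric d_n satisfies log N(δ, B(L), d_n) ≤ 6^α K (2 L δ^{-1} + 1) + 4^α K R^α δ^{-α}. -/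
open Set
open scoped ENNReal

/-- The empirical pseudo-metric given design points `t_1, …, t_n`:
`d_n(f,g) = ((1/n) ∑ᵢ d(f(tᵢ), g(tᵢ))²)^{1/2}`. -/
noncomputable def dn {X : Type*} [PseudoMetricSpace X] {n : ℕ} (t : Fin n → ℝ)
    (f g : ℝ → X) : ℝ :=
  Real.sqrt ((1 / (n : ℝ)) * ∑ i, dist (f (t i)) (g (t i)) ^ 2)

/-- entropy bound for Lipschitz classes.  Suppose `X` has diameter at most
`R > 0` and every closed ball `B_x(δ)` in `X` admits, for every `ε > 0`, a covering by
balls of radius `εδ` with log-cardinality at most `K ε^{-α}`.  Then for any design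
points in `[0,1]` and any `δ > 0`, the class `B(L)` of `L`-Lipschitz functions
`[0,1] → X` admits a covering in the empirical pseudo-metric `d_n` by balls of radius
`δ` with log-cardinality at most `6^α K (2L δ⁻¹ + 1) + 4^α K R^α δ^{-α}`. -/
theorem entropy_lipschitz_class {X : Type*} [MetricSpace X]
    (R : ℝ) (hR : 0 < R) (hdiam : ∀ x y : X, dist x y ≤ R)
    (α K : ℝ) (hα : 0 < α) (hK : 0 < K)
    (hent : ∀ (x : X) (ε δ : ℝ), 0 < ε → 0 < δ →
      ∃ T : Finset X, (∀ y ∈ Metric.closedBall x δ, ∃ c ∈ T, dist y c ≤ ε * δ) ∧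
        Real.log T.card ≤ K * ε ^ (-α))
    (L : ℝ) (hL : 0 < L)
    (n : ℕ) (hn : 1 ≤ n) (t : Fin n → ℝ) (ht01 : ∀ i, t i ∈ Set.Icc (0 : ℝ) 1)
    (δ : ℝ) (hδ : 0 < δ) :
    ∃ T : Finset (ℝ → X),
      (∀ f : ℝ → X,
          (∀ s ∈ Set.Icc (0 : ℝ) 1, ∀ u ∈ Set.Icc (0 : ℝ) 1,
            dist (f s) (f u) ≤ L * |s - u|) →
          ∃ c ∈ T, dn t f c ≤ δ) ∧
      Real.log T.card ≤
        6 ^ α * K * (2 * L * δ⁻¹ + 1) + 4 ^ α * K * R ^ α * δ ^ (-α) := by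
  classical
  rcases isEmpty_or_nonempty X with hX | ⟨⟨x0⟩⟩
  · refine ⟨∅, fun f _ => (hX.false (f 0)).elim, ?_⟩
    simp only [Finset.card_empty, Nat.cast_zero, Real.log_zero]
    positivity
  have hent' : ∀ (x : X) (ε δ : ℝ), 0 < ε → 0 < δ →
      ∃ T : Finset X, (∀ y ∈ Metric.closedBall x δ, ∃ c ∈ T, dist y c ≤ ε * δ) ∧
        (T.card : ℝ) ≤ Real.exp (K * ε ^ (-α)) := by
    intro x ε δ hε hδ
    obtain ⟨T, h1, h2⟩ := hent x ε δ hε hδ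
    exact ⟨T, h1, (Real.le_exp_log _).trans (Real.exp_le_exp.2 h2)⟩
  set A := K * (δ / (2 * R)) ^ (-α) with hA
  set B := K * (1 / 2 : ℝ) ^ (-α) with hB
  set h := δ / (2 * L) with hh
  have hpos : 0 < h := by positivity
  have hLh : L * h = δ / 2 := by rw [hh]; field_simp
  have key : ∀ m : ℕ, (m : ℝ) * h ≤ 1 → ∃ T : Finset (ℕ → X),
      (∀ f : ℝ → X, (∀ s ∈ Set.Icc (0 : ℝ) 1, ∀ u ∈ Set.Icc (0 : ℝ) 1,
            dist (f s) (f u) ≤ L * |s - u|) →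
        ∃ c ∈ T, ∀ j ≤ m, dist (f (j * h)) (c j) ≤ δ / 2) ∧
      (T.card : ℝ) ≤ Real.exp (A + m * B) := by
    intro m
    induction m with
    | zero =>
      intro _
      obtain ⟨T, h1, h2⟩ := hent' x0 (δ / (2 * R)) R (by positivity) hR
      refine ⟨T.image (fun x _ => x), ?_, ?_⟩
      · intro f _
        obtain ⟨c, hc, hd⟩ := h1 (f 0) (Metric.mem_closedBall.2 (hdiam _ _))
        refine ⟨fun _ => c, Finset.mem_image_of_mem _ hc, fun j hj => ?_⟩
        obtain rfl : j = 0 := by omega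
        have : δ / (2 * R) * R = δ / 2 := by field_simp
        rw [this] at hd
        simpa using hd
      · simp only [Nat.cast_zero, zero_mul, add_zero]
        exact le_trans (by exact_mod_cast Finset.card_image_le) h2
    | succ m ih =>
      intro hm
      push_cast at hm
      obtain ⟨T, h1, h2⟩ := ih (by nlinarith)
      choose S hS1 hS2 using fun x : X => hent' x (1 / 2) δ (by norm_num) hδ
      refine ⟨T.biUnion fun c => (S (c m)).image fun x => Function.update c (m + 1) x, ?_, ?_⟩
      · intro f hf
        obtain ⟨c, hc, hd⟩ := h1 f hf
        have hm0 : (0 : ℝ) ≤ m * h := by positivity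
        have hstep := hf (((m + 1 : ℕ) : ℝ) * h) ⟨by positivity, by push_cast; exact hm⟩
          (m * h) ⟨hm0, by nlinarith⟩
        have e : |((m + 1 : ℕ) : ℝ) * h - m * h| = h := by
          rw [← abs_of_pos hpos]; push_cast; congr 1; rw [abs_of_pos hpos]; ring
        rw [e, hLh] at hstep
        obtain ⟨x, hx, hxd⟩ := hS1 (c m) (f (((m + 1 : ℕ) : ℝ) * h)) (by
          rw [Metric.mem_closedBall]
          have := dist_triangle (f (((m + 1 : ℕ) : ℝ) * h)) (f (m * h)) (c m)
          have := hd m le_rfl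
          linarith)
        refine ⟨Function.update c (m + 1) x, Finset.mem_biUnion.2
          ⟨c, hc, Finset.mem_image.2 ⟨x, hx, rfl⟩⟩, fun j hj => ?_⟩
        rcases eq_or_ne j (m + 1) with rfl | hne
        · rw [Function.update_self]; linarith
        · rw [Function.update_of_ne hne]; exact hd j (by omega)
      · have c1 : ((T.biUnion fun c => (S (c m)).image
            fun x => Function.update c (m + 1) x).card : ℝ) ≤ ∑ c ∈ T, ((S (c m)).card : ℝ) := by
          exact_mod_cast Finset.card_biUnion_le.trans
            (Finset.sum_le_sum fun c _ => Finset.card_image_le)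
        have c2 : ∑ c ∈ T, ((S (c m)).card : ℝ) ≤ T.card * Real.exp B := by
          rw [← nsmul_eq_mul]
          exact Finset.sum_le_card_nsmul _ _ _ fun c _ => hS2 _
        have c3 : A + ((m + 1 : ℕ) : ℝ) * B = (A + m * B) + B := by push_cast; ring
        rw [c3, Real.exp_add]
        exact c1.trans (c2.trans (by gcongr))
  obtain ⟨T, h1, h2⟩ := key ⌊1 / h⌋₊ (by
    rw [← le_div_iff₀ hpos]; exact Nat.floor_le (by positivity))
  refine ⟨T.image fun c s => c ⌊s / h⌋₊, ?_, ?_⟩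
  · intro f hf
    obtain ⟨c, hc, hd⟩ := h1 f hf
    refine ⟨_, Finset.mem_image_of_mem _ hc, ?_⟩
    have pt : ∀ i, dist (f (t i)) (c ⌊t i / h⌋₊) ≤ δ := by
      intro i
      obtain ⟨a, b⟩ := ht01 i
      have q := hd ⌊t i / h⌋₊ (Nat.floor_le_floor (by gcongr))
      have l1 : (⌊t i / h⌋₊ : ℝ) * h ≤ t i := by
        rw [← le_div_iff₀ hpos]; exact Nat.floor_le (by positivity)
      have l2 : t i < ((⌊t i / h⌋₊ : ℝ) + 1) * h := by
        rw [← div_lt_iff₀ hpos]; exact Nat.lt_floor_add_one _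
      have q2 := hf (t i) ⟨a, b⟩ (⌊t i / h⌋₊ * h) ⟨by positivity, l1.trans b⟩
      have q3 : |t i - ⌊t i / h⌋₊ * h| ≤ h := by
        rw [abs_of_nonneg (by linarith)]; linarith
      have q4 := mul_le_mul_of_nonneg_left q3 hL.le
      have := dist_triangle (f (t i)) (f (⌊t i / h⌋₊ * h)) (c ⌊t i / h⌋₊)
      linarith
    unfold dn
    apply Real.sqrt_le_iff.2 ⟨hδ.le, ?_⟩
    have hn' : (0 : ℝ) < n := by exact_mod_cast hn
    have : ∑ i, dist (f (t i)) (c ⌊t i / h⌋₊) ^ 2 ≤ n * δ ^ 2 := by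
      refine (Finset.sum_le_sum fun i _ => pow_le_pow_left₀ dist_nonneg (pt i) 2).trans ?_
      simp
    rw [one_div, inv_mul_le_iff₀ hn']
    exact this
  · have hB0 : B = 2 ^ α * K := by
      rw [hB, Real.rpow_neg (by norm_num), ← Real.inv_rpow (by norm_num)]; norm_num; ring
    have hA0 : A = 2 ^ α * K * R ^ α * δ ^ (-α) := by
      rw [hA, Real.rpow_neg (by positivity), Real.div_rpow hδ.le (by positivity),
        Real.mul_rpow (by norm_num) hR.le, Real.rpow_neg hδ.le, inv_div]
      ring
    have g1 : (2 : ℝ) ^ α ≤ 4 ^ α := Real.rpow_le_rpow (by norm_num) (by norm_num) hα.le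
    have g2 : (2 : ℝ) ^ α ≤ 6 ^ α := Real.rpow_le_rpow (by norm_num) (by norm_num) hα.le
    have hAle : A ≤ 4 ^ α * K * R ^ α * δ ^ (-α) := by rw [hA0]; gcongr
    have hm : (⌊1 / h⌋₊ : ℝ) ≤ 2 * L * δ⁻¹ + 1 := by
      have e : 1 / h = 2 * L * δ⁻¹ := by rw [hh]; field_simp
      have := Nat.floor_le (show 0 ≤ 1 / h by positivity)
      linarith
    have hBle : (⌊1 / h⌋₊ : ℝ) * B ≤ 6 ^ α * K * (2 * L * δ⁻¹ + 1) := by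
      rw [hB0, mul_comm]; gcongr
    have hA1 : 0 ≤ A := by positivity
    have hB1 : 0 ≤ (⌊1 / h⌋₊ : ℝ) * B := by positivity
    have hc : ((T.image fun c (s : ℝ) => c ⌊s / h⌋₊).card : ℝ) ≤
        Real.exp (A + ⌊1 / h⌋₊ * B) :=
      le_trans (by exact_mod_cast Finset.card_image_le) h2
    rcases Nat.eq_zero_or_pos (T.image fun c (s : ℝ) => c ⌊s / h⌋₊).card with h0 | h0
    · rw [h0, Nat.cast_zero, Real.log_zero]; linarith
    · have := (Real.log_le_iff_le_exp (by exact_mod_cast h0)).2 hc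
      linarith
end

section
/- Let H be a real Hilbert space, let p_1, p_2 ∈ H with p_1 ≠ p_2, let α > 0, and set θ = min( α / ‖p_1 − p_2‖, 1/2 ). Then the pair (q_1*, q_2*) with q_1* = p_1 + θ (p_2 − p_1) and q_2* = p_2 + θ (p_1 − p_2) minimizes the proximal objective F(q_1, q_2) = α ‖q_1 − q_2‖ + (1/2) ‖q_1 − p_1‖² + (1/2) ‖q_2 − p_2‖² over all (q_1, q_2) ∈ H × H. (This is the Hilbert-space case of the proximal mapping formula for the total variation term used in the cyclic proximal point algorithm.) -/
/-- in a real Hilbert space, with `θ = min(α/‖p₁ - p₂‖, 1/2)`, the pair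
`(q₁*, q₂*) = (p₁ + θ(p₂ - p₁), p₂ + θ(p₁ - p₂))` minimizes the proximal objective
`F(q₁, q₂) = α ‖q₁ - q₂‖ + (1/2)‖q₁ - p₁‖² + (1/2)‖q₂ - p₂‖²` over `H × H`. -/
theorem prox_tv_pair_minimizer {H : Type*} [NormedAddCommGroup H]
    [InnerProductSpace ℝ H] [CompleteSpace H]
    (p1 p2 : H) (hne : p1 ≠ p2) (α : ℝ) (hα : 0 < α) :
    ∀ q1 q2 : H,
      α * ‖(p1 + min (α / ‖p1 - p2‖) (1 / 2) • (p2 - p1)) -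
            (p2 + min (α / ‖p1 - p2‖) (1 / 2) • (p1 - p2))‖ +
          (1 / 2) * ‖(p1 + min (α / ‖p1 - p2‖) (1 / 2) • (p2 - p1)) - p1‖ ^ 2 +
          (1 / 2) * ‖(p2 + min (α / ‖p1 - p2‖) (1 / 2) • (p1 - p2)) - p2‖ ^ 2 ≤
        α * ‖q1 - q2‖ + (1 / 2) * ‖q1 - p1‖ ^ 2 + (1 / 2) * ‖q2 - p2‖ ^ 2 := by
  intro q1 q2
  have hd : 0 < ‖p1 - p2‖ := norm_pos_iff.mpr (sub_ne_zero.mpr hne)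
  have htri : ‖p1 - p2‖ ≤ ‖q1 - q2‖ + ‖q1 - p1‖ + ‖q2 - p2‖ := by
    have e : p1 - p2 = (q1 - q2) - (q1 - p1) + (q2 - p2) := by abel
    rw [e]
    exact (norm_add_le _ _).trans (by gcongr; exact norm_sub_le _ _)
  have hθ0 : 0 ≤ min (α / ‖p1 - p2‖) (1 / 2) := le_min (by positivity) (by norm_num)
  have hθ1 : min (α / ‖p1 - p2‖) (1 / 2) ≤ 1 / 2 := min_le_right _ _
  have hθ : (min (α / ‖p1 - p2‖) (1 / 2) * ‖p1 - p2‖ = α) ∨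
      (min (α / ‖p1 - p2‖) (1 / 2) = 1 / 2 ∧ ‖p1 - p2‖ ≤ 2 * α) := by
    rcases le_total (α / ‖p1 - p2‖) (1 / 2) with h | h
    · left
      rw [min_eq_left h]
      field_simp
    · right
      refine ⟨min_eq_right h, ?_⟩
      rw [le_div_iff₀ hd] at h
      linarith
  generalize min (α / ‖p1 - p2‖) (1 / 2) = θ at *
  have e1 : (p1 + θ • (p2 - p1)) - (p2 + θ • (p1 - p2)) = (1 - 2 * θ) • (p1 - p2) := by
    module
  rw [e1, add_sub_cancel_left, add_sub_cancel_left, norm_smul, norm_smul, norm_smul,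
    norm_sub_rev p2 p1, Real.norm_of_nonneg hθ0, Real.norm_of_nonneg (by linarith)]
  have hr := norm_nonneg (q1 - q2)
  generalize ‖p1 - p2‖ = d at *
  generalize ‖q1 - q2‖ = r at *
  generalize ‖q1 - p1‖ = a at *
  generalize ‖q2 - p2‖ = b at *
  rcases hθ with h | ⟨h, h2⟩
  · have : (1 - 2 * θ) * d = d - 2 * α := by linarith
    rw [this, h]
    nlinarith [sq_nonneg (a - b), sq_nonneg ((a + b) / 2 - α),
      mul_le_mul_of_nonneg_left htri hα.le]
  · subst h
    nlinarith [sq_nonneg (a - b), sq_nonneg (d - (a + b)),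
      mul_le_mul_of_nonneg_left htri hd.le, mul_le_mul_of_nonneg_right h2 hr]
end

section
/- Let (M,d) be a metric space and f, g : [0,1] → M functions with sup_{t ∈ [0,1]} d(f(t), g(t)) ≤ B and TV(f) + TV(g) ≤ 2C for constants B, C > 0. For n ≥ 2 let t_i = (i−1)/(n−1) for i = 1, …, n. Then the squared-distance function t ↦ d(f(t), g(t))² is Riemann integrable on [0,1] and ∫_0^1 d(f(t), g(t))² dt ≤ (1/(n−1)) Σ_{i=1}^{n−1} d(f(t_i), g(t_i))² + 4BC/(n−1). (This deterministic bound underlies the paper's claim that convergence of the empirical discrepancy d_n(μ̂, μ) implies convergence of the integrated squared discrepancy when TV(μ̂) and TV(μ) are bounded and the design points are equidistant.) -/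
open Set MeasureTheory
open scoped ENNReal

theorem aux_bound (q W : ℝ → ℝ) (N : ℕ) (hN : 0 < N)
    (h : ∀ x ∈ Set.Icc (0:ℝ) 1, ∀ y ∈ Set.Icc (0:ℝ) 1, x ≤ y → |q y - q x| ≤ W y - W x) :
    IntervalIntegrable q volume 0 1 ∧
      (∫ s in (0 : ℝ)..1, q s) ≤
        (1 / (N : ℝ)) * ∑ i ∈ Finset.range N, q ((i : ℝ) / (N : ℝ)) + (W 1 - W 0) / N := by
  have hN' : (0:ℝ) < N := by exact_mod_cast hN
  have hW : MonotoneOn W (Set.uIcc 0 1) := by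
    rw [Set.uIcc_of_le zero_le_one]
    intro x hx y hy hxy
    have := h x hx y hy hxy
    linarith [abs_nonneg (q y - q x)]
  have hqW : MonotoneOn (fun x => q x + W x) (Set.uIcc 0 1) := by
    rw [Set.uIcc_of_le zero_le_one]
    intro x hx y hy hxy
    have := h x hx y hy hxy
    have := neg_abs_le (q y - q x)
    simp only
    linarith
  have hint : IntervalIntegrable q volume 0 1 := by
    have h1 := (hqW.intervalIntegrable (μ := volume)).sub (hW.intervalIntegrable (μ := volume))
    refine h1.congr ?_
    intro x _
    simp
  refine ⟨hint, ?_⟩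
  have hmem : ∀ i : ℕ, i ≤ N → (i:ℝ) / N ∈ Set.Icc (0:ℝ) 1 := by
    intro i hi
    have : (i:ℝ) ≤ N := by exact_mod_cast hi
    exact ⟨by positivity, by rw [div_le_one hN']; exact this⟩
  have hle : ∀ i : ℕ, (i:ℝ) / N ≤ ((i+1 : ℕ):ℝ) / N := by
    intro i
    push_cast
    gcongr
    linarith
  have hii : ∀ i < N, IntervalIntegrable q volume ((i:ℝ) / N) (((i+1 : ℕ):ℝ) / N) := by
    intro i hi
    refine hint.mono_set ?_
    rw [Set.uIcc_of_le zero_le_one, Set.uIcc_of_le (hle i)]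
    exact Set.Icc_subset_Icc (hmem i hi.le).1 (hmem (i+1) hi).2
  have hsum := intervalIntegral.sum_integral_adjacent_intervals (a := fun i : ℕ => (i:ℝ)/N) hii
  have e0 : ((0:ℕ):ℝ) / N = 0 := by simp
  have e1 : (N:ℝ) / N = 1 := div_self hN'.ne'
  simp only [e0, e1] at hsum
  rw [← hsum]
  have hstep : ∀ i ∈ Finset.range N, (∫ s in ((i:ℝ) / N)..(((i+1 : ℕ):ℝ) / N), q s) ≤
      (1 / (N:ℝ)) * (q ((i:ℝ)/N) + (W (((i+1 : ℕ):ℝ) / N) - W ((i:ℝ)/N))) := by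
    intro i hi
    have hi := Finset.mem_range.1 hi
    have := intervalIntegral.integral_mono_on (hle i) (hii i hi)
      (intervalIntegrable_const (μ := volume)
        (c := q ((i:ℝ)/N) + (W (((i+1 : ℕ):ℝ) / N) - W ((i:ℝ)/N)))) (by
        intro x hx
        have hx' : x ∈ Set.Icc (0:ℝ) 1 :=
          ⟨(hmem i hi.le).1.trans hx.1, hx.2.trans (hmem (i+1) hi).2⟩
        have a1 := (le_abs_self _).trans (h _ (hmem i hi.le) x hx' hx.1)
        have a2 := (abs_nonneg _).trans (h x hx' _ (hmem (i+1) hi) hx.2)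
        linarith)
    refine this.trans (le_of_eq ?_)
    rw [intervalIntegral.integral_const, smul_eq_mul]
    congr 1
    push_cast
    ring
  refine (Finset.sum_le_sum hstep).trans (le_of_eq ?_)
  rw [← Finset.mul_sum, Finset.sum_add_distrib,
    Finset.sum_range_sub (fun i : ℕ => W ((i:ℝ)/N)), e0, e1]
  ring

theorem aux_var_s12 {M : Type*} [MetricSpace M] (f : ℝ → M) (hf : TV f ≠ ⊤) :
    ∀ x ∈ Set.Icc (0:ℝ) 1, ∀ y ∈ Set.Icc (0:ℝ) 1, x ≤ y → dist (f x) (f y) ≤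
      (eVariationOn f (Set.Icc 0 y)).toReal - (eVariationOn f (Set.Icc 0 x)).toReal := by
  intro x hx y hy hxy
  have hfin : ∀ a b : ℝ, 0 ≤ a → b ≤ 1 → eVariationOn f (Set.Icc a b) ≠ ⊤ := fun a b ha hb =>
    ne_top_of_le_ne_top hf (eVariationOn.mono f (Set.Icc_subset_Icc ha hb))
  have h1 := eVariationOn.Icc_add_Icc f (s := Set.univ) hx.1 hxy (Set.mem_univ _)
  simp only [Set.univ_inter] at h1
  rw [← h1, ENNReal.toReal_add (hfin _ _ le_rfl hx.2) (hfin _ _ hx.1 hy.2)]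
  have : BoundedVariationOn f (Set.Icc x y) := hfin _ _ hx.1 hy.2
  have := this.dist_le (x := x) (y := y) ⟨le_rfl, hxy⟩ ⟨hxy, le_rfl⟩
  linarith

/-- if `f, g : [0,1] → M` satisfy `sup_t d(f(t), g(t)) ≤ B` and
`TV(f) + TV(g) ≤ 2C`, and `t_i = (i-1)/(n-1)` for `i = 1, …, n` with `n ≥ 2`, then
`t ↦ d(f(t), g(t))²` is integrable on `[0,1]` and
`∫₀¹ d(f(t), g(t))² dt ≤ (1/(n-1)) ∑_{i=1}^{n-1} d(f(t_i), g(t_i))² + 4BC/(n-1)`. -/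
theorem integrated_squared_discrepancy_bound {M : Type*} [MetricSpace M]
    (f g : ℝ → M) (B C : ℝ) (hB : 0 < B) (hC : 0 < C)
    (hbd : ∀ s ∈ Set.Icc (0 : ℝ) 1, dist (f s) (g s) ≤ B)
    (htv : TV f + TV g ≤ ENNReal.ofReal (2 * C))
    (n : ℕ) (hn : 2 ≤ n) :
    IntervalIntegrable (fun s => dist (f s) (g s) ^ 2) volume 0 1 ∧
      (∫ s in (0 : ℝ)..1, dist (f s) (g s) ^ 2) ≤
        (1 / ((n : ℝ) - 1)) * ∑ i ∈ Finset.range (n - 1),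
            dist (f ((i : ℝ) / ((n : ℝ) - 1))) (g ((i : ℝ) / ((n : ℝ) - 1))) ^ 2 +
          4 * B * C / ((n : ℝ) - 1) := by
  have hf : TV f ≠ ⊤ := ne_top_of_le_ne_top ENNReal.ofReal_ne_top (le_self_add.trans htv)
  have hg : TV g ≠ ⊤ := ne_top_of_le_ne_top ENNReal.ofReal_ne_top (le_add_self.trans htv)
  obtain ⟨N, rfl⟩ : ∃ N, n = N + 1 := ⟨n - 1, by omega⟩
  have hN : 0 < N := by omega
  have hN' : (0:ℝ) < N := by exact_mod_cast hN
  have key := aux_bound (fun s => dist (f s) (g s) ^ 2)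
    (fun s => 2 * B * ((eVariationOn f (Set.Icc 0 s)).toReal +
      (eVariationOn g (Set.Icc 0 s)).toReal)) N hN (by
      intro x hx y hy hxy
      have h1 := aux_var_s12 f hf x hx y hy hxy
      have h2 := aux_var_s12 g hg x hx y hy hxy
      have h3 : |dist (f y) (g y) - dist (f x) (g x)| ≤ dist (f x) (f y) + dist (g x) (g y) := by
        have t1 := dist_triangle4 (f y) (f x) (g x) (g y)
        have t2 := dist_triangle4 (f x) (f y) (g y) (g x)
        rw [dist_comm (f y) (f x)] at t1
        rw [dist_comm (g y) (g x)] at t2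
        rw [abs_le]
        constructor <;> linarith
      have h4 : |dist (f y) (g y) + dist (f x) (g x)| ≤ 2 * B := by
        rw [abs_of_nonneg (by positivity)]
        linarith [hbd x hx, hbd y hy]
      rw [sq_sub_sq, abs_mul, ← mul_sub]
      refine mul_le_mul h4 (by linarith) (abs_nonneg _) (by positivity))
  have hcast : ((N + 1 : ℕ) : ℝ) - 1 = N := by push_cast; ring
  rw [hcast, Nat.add_sub_cancel]
  refine ⟨key.1, key.2.trans ?_⟩
  gcongr
  have h0 : ∀ k : ℝ → M, eVariationOn k (Set.Icc 0 0) = 0 := fun k =>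
    eVariationOn.subsingleton k (by simp)
  have ht := ENNReal.toReal_mono ENNReal.ofReal_ne_top htv
  rw [ENNReal.toReal_add hf hg, ENNReal.toReal_ofReal (by positivity)] at ht
  unfold TV at ht
  simp only [h0, ENNReal.toReal_zero]
  nlinarith
end
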